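/- Let n ≥ 3, α ∈ [2,n), σ < α and 1 < p < (n + α − 2σ)/(n − α). Suppose u is a positive radially decreasing function, continuous on ℝⁿ and continuously differentiable on ℝⁿ∖{0}, such that for every x ∈ ℝⁿ the integral ∫_{ℝⁿ} u(y)^p |x−y|^{α−n} |y|^{−σ} dy is finite and u(x) = ∫_{ℝⁿ} u(y)^p |x−y|^{α−n} |y|^{−σ} dy. Then ∫_{ℝⁿ} u(x)^p |x|^{−σ} (x·∇u(x)) dx = −((n−σ)/(p+1)) ∫_{ℝⁿ} u(x)^{p+1} |x|^{−σ} dx, both integrals being absolutely convergent. -/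

import Mathlib

open MeasureTheory RealInnerProductSpace

noncomputable section

/-- `w : ℝⁿ → ℝ` is radially decreasing if `w(x) = W(‖x‖)` for some
nonincreasing `W : [0,∞) → (0,∞)`. -/
def RadiallyDecreasing {n : ℕ} (w : EuclideanSpace ℝ (Fin n) → ℝ) : Prop :=
  ∃ W : ℝ → ℝ, AntitoneOn W (Set.Ici 0) ∧ (∀ r, 0 ≤ r → 0 < W r) ∧
    ∀ x, w x = W ‖x‖

open Set Filter Topology Module

/-- Near the origin `V ^ q * r ^ (m - 1)` is controlled by `r ^ (m - 1)`, and at infinity by the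
decay of `V`. -/
theorem integrableOn_rpow_mul_rpow_of_decay {V : ℝ → ℝ} {q m b C : ℝ} (hV : Continuous V)
    (hpos : ∀ r, 0 < V r) (hanti : AntitoneOn V (Ici 0)) (hq : 0 < q) (hm : 0 < m) (hb : m < b)
    (hdecay : ∀ r, 0 < r → V r ^ q ≤ C * r ^ (-b)) :
    IntegrableOn (fun r => V r ^ q * r ^ (m - 1)) (Ioi 0) := by
  have hcont : ContinuousOn (fun r => V r ^ q * r ^ (m - 1)) (Ioi 0) := fun r hr =>
    ((hV.continuousAt.rpow_const (Or.inl (hpos r).ne')).mul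
      (Real.continuousAt_rpow_const _ _ (Or.inl (ne_of_gt hr)))).continuousWithinAt
  rw [← Ioc_union_Ioi_eq_Ioi (zero_le_one (α := ℝ))]
  refine IntegrableOn.union ?_ ?_
  · have h : IntegrableOn (fun r : ℝ => V 0 ^ q * r ^ (m - 1)) (Ioc 0 1) :=
      ((intervalIntegral.intervalIntegrable_rpow' (a := 0) (b := 1)
        (by linarith : -1 < m - 1)).1).const_mul _
    refine Integrable.mono' h
      ((hcont.mono Ioc_subset_Ioi_self).aestronglyMeasurable measurableSet_Ioc) ?_
    refine (ae_restrict_iff' measurableSet_Ioc).2 (ae_of_all _ fun r hr => ?_)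
    have hr0 : 0 ≤ r ^ (m - 1) := Real.rpow_nonneg hr.1.le _
    rw [Real.norm_of_nonneg (mul_nonneg (Real.rpow_nonneg (hpos r).le _) hr0)]
    exact mul_le_mul_of_nonneg_right (Real.rpow_le_rpow (hpos r).le
      (hanti self_mem_Ici (mem_Ici.2 hr.1.le) hr.1.le) hq.le) hr0
  · have h : IntegrableOn (fun r : ℝ => C * r ^ (m - 1 - b)) (Ioi 1) :=
      (integrableOn_Ioi_rpow_of_lt (by linarith) one_pos).const_mul _
    refine Integrable.mono' h
      ((hcont.mono (Ioi_subset_Ioi zero_le_one)).aestronglyMeasurable measurableSet_Ioi) ?_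
    refine (ae_restrict_iff' measurableSet_Ioi).2 (ae_of_all _ fun r hr => ?_)
    have hr0 : 0 < r := one_pos.trans hr
    have hr1 : 0 ≤ r ^ (m - 1) := Real.rpow_nonneg hr0.le _
    rw [Real.norm_of_nonneg (mul_nonneg (Real.rpow_nonneg (hpos r).le _) hr1)]
    refine (mul_le_mul_of_nonneg_right (hdecay r hr0) hr1).trans_eq ?_
    rw [mul_assoc, ← Real.rpow_add hr0]
    ring_nf

/-- Integration by parts on the half line for a decreasing profile with sufficient decay. -/
theorem integral_rpow_mul_deriv_mul_rpow_of_decay {V : ℝ → ℝ} {q m b C : ℝ} (hV : Continuous V)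
    (hpos : ∀ r, 0 < V r) (hanti : AntitoneOn V (Ici 0))
    (hdiff : ∀ r, 0 < r → DifferentiableAt ℝ V r) (hq : 0 < q) (hm : 0 < m) (hb : m < b)
    (hdecay : ∀ r, 0 < r → V r ^ q ≤ C * r ^ (-b)) :
    IntegrableOn (fun r => V r ^ (q - 1) * deriv V r * r ^ m) (Ioi 0) ∧
    ∫ r in Ioi 0, V r ^ (q - 1) * deriv V r * r ^ m =
      -(m / q) * ∫ r in Ioi 0, V r ^ q * r ^ (m - 1) := by
  set f : ℝ → ℝ := fun r => V r ^ q * r ^ (m - 1) with hf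
  have hfint : IntegrableOn f (Ioi 0) :=
    integrableOn_rpow_mul_rpow_of_decay hV hpos hanti hq hm hb hdecay
  have hfcont : ContinuousOn f (Ioi 0) := fun r hr =>
    ((hV.continuousAt.rpow_const (Or.inl (hpos r).ne')).mul
      (Real.continuousAt_rpow_const _ _ (Or.inl (ne_of_gt hr)))).continuousWithinAt
  have hfii : ∀ r, 0 ≤ r → IntervalIntegrable f volume 0 r := fun r hr =>
    (intervalIntegrable_iff_integrableOn_Ioc_of_le hr).2 (hfint.mono_set Ioc_subset_Ioi_self)
  set G : ℝ → ℝ := fun r => V r ^ q * r ^ m / q - m / q * ∫ s in (0 : ℝ)..r, f s with hG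
  have hGcont : ContinuousWithinAt G (Ici 0) 0 := by
    have h1 : ContinuousWithinAt (fun r => ∫ s in (0 : ℝ)..r, f s) (Ici 0) 0 := by
      have := intervalIntegral.continuousOn_primitive_interval (μ := volume) (f := f)
        (a := 0) (b := 1) (by
          rw [uIcc_of_le zero_le_one]
          exact (integrableOn_Icc_iff_integrableOn_Ioc).2 (hfint.mono_set Ioc_subset_Ioi_self))
      rw [uIcc_of_le zero_le_one] at this
      exact (this 0 (by simp)).mono_of_mem_nhdsWithin (Icc_mem_nhdsGE one_pos)
    have h2 : ContinuousAt (fun r => V r ^ q * r ^ m / q) 0 :=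
      ((hV.continuousAt.rpow_const (Or.inl (hpos 0).ne')).mul
        (Real.continuousAt_rpow_const _ _ (Or.inr hm.le))).div_const _
    exact h2.continuousWithinAt.sub (continuousWithinAt_const.mul h1)
  have hGderiv : ∀ r ∈ Ioi (0 : ℝ), HasDerivAt G (V r ^ (q - 1) * deriv V r * r ^ m) r := by
    intro r hr
    have hr0 : 0 < r := hr
    have h1 : HasDerivAt (fun r => ∫ s in (0 : ℝ)..r, f s) (f r) r :=
      intervalIntegral.integral_hasDerivAt_right (hfii r hr0.le)
        (hfcont.stronglyMeasurableAtFilter isOpen_Ioi r hr)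
        (hfcont.continuousAt (Ioi_mem_nhds hr0))
    have h2 := (((hdiff r hr0).hasDerivAt.rpow_const (p := q) (Or.inl (hpos r).ne')).mul
      (Real.hasDerivAt_rpow_const (p := m) (Or.inl hr0.ne'))).div_const q
    refine (h2.sub (h1.const_mul (m / q))).congr_deriv ?_
    simp only [hf]
    field_simp
    ring
  have hGneg : ∀ r ∈ Ioi (0 : ℝ), V r ^ (q - 1) * deriv V r * r ^ m ≤ 0 := by
    intro r hr
    have hd : deriv V r ≤ 0 := by
      rw [← derivWithin_of_mem_nhds (Ici_mem_nhds hr)]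
      exact hanti.derivWithin_nonpos
    exact mul_nonpos_of_nonpos_of_nonneg
      (mul_nonpos_of_nonneg_of_nonpos (Real.rpow_nonneg (hpos r).le _) hd)
      (Real.rpow_nonneg (le_of_lt hr) _)
  have hGlim : Tendsto G atTop (𝓝 (0 / q - m / q * ∫ r in Ioi 0, f r)) := by
    refine Tendsto.sub (Tendsto.div_const ?_ q)
      (tendsto_const_nhds.mul (intervalIntegral_tendsto_integral_Ioi 0 hfint tendsto_id))
    have h0 : Tendsto (fun r : ℝ => C * r ^ (-(b - m))) atTop (𝓝 0) := by
      simpa using (tendsto_rpow_neg_atTop (sub_pos.2 hb)).const_mul C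
    refine squeeze_zero' ?_ ?_ h0
    · filter_upwards [eventually_gt_atTop 0] with r hr
      exact mul_nonneg (Real.rpow_nonneg (hpos r).le _) (Real.rpow_nonneg hr.le _)
    · filter_upwards [eventually_gt_atTop 0] with r hr
      refine (mul_le_mul_of_nonneg_right (hdecay r hr) (Real.rpow_nonneg hr.le _)).trans_eq ?_
      rw [mul_assoc, ← Real.rpow_add hr]
      ring_nf
  refine ⟨integrableOn_Ioi_deriv_of_nonpos hGcont hGderiv hGneg hGlim, ?_⟩
  rw [integral_Ioi_of_hasDerivAt_of_nonpos hGcont hGderiv hGneg hGlim]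
  simp [hG, Real.zero_rpow hm.ne']

/-- Integral of a power of the norm over a centred ball. -/
theorem integral_indicator_ball_norm_rpow {n : ℕ} (hn : 0 < n) {σ R : ℝ} (hσ : σ < n)
    (hR : 0 < R) :
    ∫ y : EuclideanSpace ℝ (Fin n), (Metric.ball 0 R).indicator (fun y => ‖y‖ ^ (-σ)) y =
      n * volume.real (Metric.ball (0 : EuclideanSpace ℝ (Fin n)) 1) *
        (R ^ ((n : ℝ) - σ) / (n - σ)) := by
  have : Nonempty (Fin n) := ⟨⟨0, hn⟩⟩
  have h1 : (fun y : EuclideanSpace ℝ (Fin n) =>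
      (Metric.ball 0 R).indicator (fun y => ‖y‖ ^ (-σ)) y) =
      fun y => (Iio R).indicator (fun r : ℝ => r ^ (-σ)) ‖y‖ := by
    ext y
    simp [indicator]
  rw [h1, integral_fun_norm_addHaar volume, finrank_euclideanSpace_fin]
  have h2 : ∫ r in Ioi (0 : ℝ), r ^ (n - 1) • (Iio R).indicator (fun r : ℝ => r ^ (-σ)) r =
      ∫ r in (0 : ℝ)..R, r ^ ((n : ℝ) - σ - 1) := by
    rw [intervalIntegral.integral_of_le hR.le, integral_Ioc_eq_integral_Ioo, ← Ioi_inter_Iio,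
      ← setIntegral_indicator measurableSet_Iio]
    refine setIntegral_congr_fun measurableSet_Ioi fun r hr => ?_
    have hr0 : 0 < r := hr
    by_cases h : r < R
    · simp only [mem_Iio, h, indicator_of_mem, smul_eq_mul]
      rw [← Real.rpow_natCast, ← Real.rpow_add hr0, Nat.cast_pred hn]
      ring_nf
    · simp [h]
  rw [h2, integral_rpow (Or.inl (by linarith)), nsmul_eq_mul, smul_eq_mul]
  simp only [sub_add_cancel]
  rw [Real.zero_rpow (by linarith), sub_zero, mul_assoc]

/-- Restricting the integral equation to the ball of radius `‖x‖` bounds `u x` from below in terms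
of `u x ^ p`. -/
theorem rpow_mul_le_of_integral_equation {n : ℕ} (hn : 0 < n) {α σ p : ℝ} (hαn : α < n)
    (hσ : σ < n) (hp : 0 < p) {u : EuclideanSpace ℝ (Fin n) → ℝ} (hupos : ∀ x, 0 < u x)
    (hanti : ∀ x y, ‖y‖ ≤ ‖x‖ → u x ≤ u y) {x : EuclideanSpace ℝ (Fin n)} (hx : x ≠ 0)
    (hint : Integrable (fun y => u y ^ p * ‖x - y‖ ^ (α - (n : ℝ)) * ‖y‖ ^ (-σ)))
    (hsol : u x = ∫ y, u y ^ p * ‖x - y‖ ^ (α - (n : ℝ)) * ‖y‖ ^ (-σ)) :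
    2 ^ (α - (n : ℝ)) * (n * volume.real (Metric.ball (0 : EuclideanSpace ℝ (Fin n)) 1) /
      (n - σ)) * ‖x‖ ^ (α - σ) * u x ^ p ≤ u x := by
  have hR : 0 < ‖x‖ := norm_pos_iff.2 hx
  have hK : 0 ≤ u x ^ p * (2 * ‖x‖) ^ (α - (n : ℝ)) := by
    have := hupos x
    positivity
  have key : ∫ y : EuclideanSpace ℝ (Fin n), u x ^ p * (2 * ‖x‖) ^ (α - (n : ℝ)) *
      (Metric.ball 0 ‖x‖).indicator (fun y => ‖y‖ ^ (-σ)) y ≤ u x := by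
    conv_rhs => rw [hsol]
    refine integral_mono_of_nonneg (ae_of_all _ fun y => ?_) hint (ae_of_all _ fun y => ?_)
    · exact mul_nonneg hK (indicator_nonneg (fun y _ => by positivity) y)
    · have hy := hupos y
      by_cases h : y ∈ Metric.ball (0 : EuclideanSpace ℝ (Fin n)) ‖x‖
      · simp only [indicator_of_mem h]
        have hyx : ‖y‖ < ‖x‖ := by simpa using h
        have hne : 0 < ‖x - y‖ := by
          have := norm_sub_norm_le x y
          linarith
        have hle : ‖x - y‖ ≤ 2 * ‖x‖ := by
          have := norm_sub_le x y
          linarith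
        refine mul_le_mul_of_nonneg_right (mul_le_mul ?_ ?_ (by positivity) (by positivity))
          (by positivity)
        · exact Real.rpow_le_rpow (hupos x).le (hanti x y hyx.le) hp.le
        · exact Real.rpow_le_rpow_of_nonpos hne hle (by linarith)
      · simp only [indicator_of_notMem h, mul_zero]
        positivity
  rw [integral_const_mul, integral_indicator_ball_norm_rpow hn hσ hR,
    Real.mul_rpow zero_le_two hR.le] at key
  refine Eq.trans_le ?_ key
  rw [show α - σ = (α - n) + (n - σ) by ring, Real.rpow_add hR]
  ring

/-- The lower bound `c * r ^ a * v ^ p ≤ v` turned into decay of `v ^ (p + 1)`. -/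
theorem rpow_add_one_le_of_mul_rpow_le {c r a p v : ℝ} (hc : 0 < c) (hr : 0 < r) (hv : 0 < v)
    (hp : 1 < p) (h : c * r ^ a * v ^ p ≤ v) :
    v ^ (p + 1) ≤ c⁻¹ ^ ((p + 1) / (p - 1)) * r ^ (-(a * ((p + 1) / (p - 1)))) := by
  have hp1 : 0 < p - 1 := by linarith
  have h1 : v ^ (p - 1) ≤ c⁻¹ * r ^ (-a) := by
    rw [Real.rpow_sub_one hv.ne', Real.rpow_neg hr.le, ← mul_inv, div_le_iff₀ hv,
      inv_mul_eq_div, le_div_iff₀ (by positivity), mul_comm]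
    exact h
  have h2 := Real.rpow_le_rpow (by positivity) h1 (by positivity : 0 ≤ (p + 1) / (p - 1))
  rwa [Real.mul_rpow (by positivity) (by positivity), ← Real.rpow_mul hv.le, ← Real.rpow_mul hr.le,
    mul_div_cancel₀ _ hp1.ne', neg_mul] at h2

/-- For a radial function the Euler operator `x · ∇u` acts as `r V'` on the profile. -/
theorem inner_gradient_eq_norm_mul_deriv {E : Type*} [NormedAddCommGroup E]
    [InnerProductSpace ℝ E] [CompleteSpace E] {u : E → ℝ} {V : ℝ → ℝ} (huV : ∀ x, u x = V ‖x‖)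
    {x : E} (hu : x ≠ 0 → DifferentiableAt ℝ u x) (hV : x ≠ 0 → DifferentiableAt ℝ V ‖x‖) :
    ⟪x, gradient u x⟫ = ‖x‖ * deriv V ‖x‖ := by
  rcases eq_or_ne x 0 with rfl | hx
  · simp
  have h1 : HasDerivAt (fun t : ℝ => u (t • x)) (fderiv ℝ u x x) 1 := by
    have hs : HasDerivAt (fun t : ℝ => t • x) x 1 := by
      simpa using (hasDerivAt_id (1 : ℝ)).smul_const x
    have hu' : HasFDerivAt u (fderiv ℝ u x) ((1 : ℝ) • x) := by
      simpa using (hu hx).hasFDerivAt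
    exact hu'.comp_hasDerivAt 1 hs
  have h2 : HasDerivAt (fun t : ℝ => V (t * ‖x‖)) (deriv V ‖x‖ * ‖x‖) 1 := by
    have hs : HasDerivAt (fun t : ℝ => t * ‖x‖) ‖x‖ 1 := by
      simpa using (hasDerivAt_id (1 : ℝ)).mul_const ‖x‖
    have hV' : HasDerivAt V (deriv V ‖x‖) (1 * ‖x‖) := by
      simpa using (hV hx).hasDerivAt
    exact hV'.comp 1 hs
  have h3 : (fun t : ℝ => u (t • x)) =ᶠ[𝓝 1] fun t => V (t * ‖x‖) := by
    filter_upwards [Ioi_mem_nhds (zero_lt_one (α := ℝ))] with t ht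
    rw [huV, norm_smul, Real.norm_of_nonneg (le_of_lt ht)]
  have h4 := h1.unique (h2.congr_of_eventuallyEq h3)
  rw [real_inner_comm, gradient, InnerProductSpace.toDual_symm_apply, h4, mul_comm]

theorem stmt_13 (n : ℕ) (hn : 3 ≤ n) (α σ p : ℝ)
    (hα2 : 2 ≤ α) (hαn : α < n) (hσ : σ < α)
    (hp1 : 1 < p) (hp : p < ((n : ℝ) + α - 2 * σ) / ((n : ℝ) - α))
    (u : EuclideanSpace ℝ (Fin n) → ℝ)
    (hupos : ∀ x, 0 < u x) (hurad : RadiallyDecreasing u) (hucont : Continuous u)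
    (huC1 : ContDiffOn ℝ 1 u {(0 : EuclideanSpace ℝ (Fin n))}ᶜ)
    (hsol : ∀ x : EuclideanSpace ℝ (Fin n),
      Integrable (fun y => u y ^ p * ‖x - y‖ ^ (α - (n : ℝ)) * ‖y‖ ^ (-σ)) ∧
      u x = ∫ y, u y ^ p * ‖x - y‖ ^ (α - (n : ℝ)) * ‖y‖ ^ (-σ)) :
    Integrable (fun x : EuclideanSpace ℝ (Fin n) =>
      u x ^ p * ‖x‖ ^ (-σ) * ⟪x, gradient u x⟫) ∧
    Integrable (fun x : EuclideanSpace ℝ (Fin n) => u x ^ (p + 1) * ‖x‖ ^ (-σ)) ∧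
    (∫ x : EuclideanSpace ℝ (Fin n), u x ^ p * ‖x‖ ^ (-σ) * ⟪x, gradient u x⟫) =
      -(((n : ℝ) - σ) / (p + 1)) *
        ∫ x : EuclideanSpace ℝ (Fin n), u x ^ (p + 1) * ‖x‖ ^ (-σ) := by
  obtain ⟨W, hWanti, -, hW⟩ := hurad
  have hn0 : 0 < n := by omega
  have : Nonempty (Fin n) := ⟨⟨0, hn0⟩⟩
  obtain ⟨e, he⟩ := exists_norm_eq (EuclideanSpace ℝ (Fin n)) zero_le_one
  have he0 : e ≠ 0 := norm_ne_zero_iff.1 (by simp [he])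
  have huanti : ∀ x y, ‖y‖ ≤ ‖x‖ → u x ≤ u y := fun x y h => by
    rw [hW, hW]
    exact hWanti (norm_nonneg y) (norm_nonneg x) h
  have hudiff : ∀ x, x ≠ 0 → DifferentiableAt ℝ u x := fun x hx =>
    (huC1.contDiffAt (isOpen_compl_singleton.mem_nhds hx)).differentiableAt one_ne_zero
  set V : ℝ → ℝ := fun r => u (r • e) with hVdef
  have hnorm : ∀ r : ℝ, 0 ≤ r → ‖r • e‖ = r := fun r hr => by
    rw [norm_smul, he, mul_one, Real.norm_of_nonneg hr]
  have huV : ∀ x, u x = V ‖x‖ := fun x => by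
    simp only [hVdef]
    rw [hW, hW, hnorm _ (norm_nonneg x)]
  have hVcont : Continuous V := by fun_prop
  have hVpos : ∀ r, 0 < V r := fun r => hupos _
  have hVanti : AntitoneOn V (Ici 0) := fun r hr s hs hrs =>
    huanti _ _ (by rwa [hnorm r hr, hnorm s hs])
  have hVdiff : ∀ r, 0 < r → DifferentiableAt ℝ V r := fun r hr =>
    (hudiff (r • e) (smul_ne_zero hr.ne' he0)).comp r
      (differentiableAt_id.smul_const e)
  have hm : 0 < (n : ℝ) - σ := by linarith
  have hb : (n : ℝ) - σ < (α - σ) * ((p + 1) / (p - 1)) := by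
    rw [lt_div_iff₀ (by linarith)] at hp
    rw [← mul_div_assoc, lt_div_iff₀ (by linarith)]
    linarith
  have hball : 0 < volume.real (Metric.ball (0 : EuclideanSpace ℝ (Fin n)) 1) :=
    ENNReal.toReal_pos (Metric.measure_ball_pos _ _ one_pos).ne' measure_ball_lt_top.ne
  set c : ℝ := 2 ^ (α - (n : ℝ)) *
    (n * volume.real (Metric.ball (0 : EuclideanSpace ℝ (Fin n)) 1) / (n - σ))
  have hc0 : 0 < c := by positivity
  have hdecay : ∀ r, 0 < r → V r ^ (p + 1) ≤
      c⁻¹ ^ ((p + 1) / (p - 1)) * r ^ (-((α - σ) * ((p + 1) / (p - 1)))) := by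
    intro r hr
    refine rpow_add_one_le_of_mul_rpow_le hc0 hr (hVpos r) hp1 ?_
    have h := rpow_mul_le_of_integral_equation hn0 hαn (by linarith) (by linarith) hupos huanti
      (smul_ne_zero hr.ne' he0) (hsol (r • e)).1 (hsol (r • e)).2
    rwa [hnorm r hr.le] at h
  have hint := integrableOn_rpow_mul_rpow_of_decay hVcont hVpos hVanti (by linarith) hm hb hdecay
  obtain ⟨hint', hparts⟩ := integral_rpow_mul_deriv_mul_rpow_of_decay hVcont hVpos hVanti hVdiff
    (by linarith) hm hb hdecay
  rw [add_sub_cancel_right] at hint' hparts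
  have hgrad : (fun x : EuclideanSpace ℝ (Fin n) => u x ^ p * ‖x‖ ^ (-σ) * ⟪x, gradient u x⟫) =
      fun x => (fun r : ℝ => V r ^ p * r ^ (-σ) * (r * deriv V r)) ‖x‖ := by
    ext x
    rw [inner_gradient_eq_norm_mul_deriv huV (hudiff x) fun hx => hVdiff _ (norm_pos_iff.2 hx),
      huV x]
  have hpow : (fun x : EuclideanSpace ℝ (Fin n) => u x ^ (p + 1) * ‖x‖ ^ (-σ)) =
      fun x => (fun r : ℝ => V r ^ (p + 1) * r ^ (-σ)) ‖x‖ := by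
    ext x
    rw [huV x]
  have hgrad_polar : EqOn (fun r : ℝ => r ^ (n - 1) • (V r ^ p * r ^ (-σ) * (r * deriv V r)))
      (fun r => V r ^ p * deriv V r * r ^ ((n : ℝ) - σ)) (Ioi 0) := by
    intro r hr
    have hr0 : 0 < r := hr
    have : r ^ ((n : ℝ) - σ) = r ^ (n - 1) * r * r ^ (-σ) := by
      rw [sub_eq_add_neg, Real.rpow_add hr0, Real.rpow_natCast, pow_sub_one_mul hn0.ne']
    simp only [this, smul_eq_mul]
    ring
  have hpow_polar : EqOn (fun r : ℝ => r ^ (n - 1) • (V r ^ (p + 1) * r ^ (-σ)))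
      (fun r => V r ^ (p + 1) * r ^ ((n : ℝ) - σ - 1)) (Ioi 0) := by
    intro r hr
    have hr0 : 0 < r := hr
    have : r ^ ((n : ℝ) - σ - 1) = r ^ (n - 1) * r ^ (-σ) := by
      rw [← Real.rpow_natCast, ← Real.rpow_add hr0, Nat.cast_pred hn0]
      ring_nf
    simp only [this, smul_eq_mul]
    ring
  rw [hgrad, hpow]
  refine ⟨(integrable_fun_norm_addHaar volume
      (f := fun r : ℝ => V r ^ p * r ^ (-σ) * (r * deriv V r))).2 ?_,
    (integrable_fun_norm_addHaar volume (f := fun r : ℝ => V r ^ (p + 1) * r ^ (-σ))).2 ?_, ?_⟩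
  · rw [finrank_euclideanSpace_fin]
    exact (integrableOn_congr_fun hgrad_polar measurableSet_Ioi).2 hint'
  · rw [finrank_euclideanSpace_fin]
    exact (integrableOn_congr_fun hpow_polar measurableSet_Ioi).2 hint
  · rw [integral_fun_norm_addHaar volume fun r : ℝ => V r ^ p * r ^ (-σ) * (r * deriv V r),
      integral_fun_norm_addHaar volume fun r : ℝ => V r ^ (p + 1) * r ^ (-σ),
      finrank_euclideanSpace_fin, setIntegral_congr_fun measurableSet_Ioi hgrad_polar,
      setIntegral_congr_fun measurableSet_Ioi hpow_polar, hparts]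
    simp only [nsmul_eq_mul, smul_eq_mul]
    ring
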